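/- arXiv:2412.18759 — 5 statements merged into one kernel-verified Lean document; each statement's English description precedes it below -/
import Mathlib

section
/- Let A be an n×n real symmetric matrix with eigenvalues μ_1, …, μ_n listed with multiplicity, and let B, C be m×m real matrices. Then the characteristic polynomial of D = C ⊗ A + B ⊗ I_n factors as det(x·I_{mn} − D) = ∏_{j=1}^{n} det(x·I_m − (B + μ_j C)). -/
open Matrix Polynomial
open scoped Kronecker

theorem Matrix.charpoly_blockDiagonal {m o R : Type*} [Fintype m] [DecidableEq m] [Fintype o]
    [DecidableEq o] [CommRing R] (M : o → Matrix m m R) :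
    (blockDiagonal M).charpoly = ∏ j, (M j).charpoly := by
  have h : (blockDiagonal M).charmatrix = blockDiagonal fun j => (M j).charmatrix := by
    ext ⟨i, k⟩ ⟨i', k'⟩ : 2
    by_cases hk : k = k' <;> by_cases hi : i = i' <;>
      simp [blockDiagonal_apply, hk, hi]
  simp only [charpoly, h, det_blockDiagonal]

/-- Conjugating `A` by an invertible matrix does not change the characteristic polynomial
of `C ⊗ A + B ⊗ 1`. -/
theorem Matrix.charpoly_kronecker_conj_add {m n R : Type*} [Fintype m] [DecidableEq m] [Fintype n]
    [DecidableEq n] [CommRing R] (B C : Matrix m m R) (A U V : Matrix n n R) (hUV : U * V = 1) :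
    (C ⊗ₖ (U * A * V) + B ⊗ₖ (1 : Matrix n n R)).charpoly =
      (C ⊗ₖ A + B ⊗ₖ (1 : Matrix n n R)).charpoly := by
  have hVU : V * U = 1 := mul_eq_one_comm.mp hUV
  have h : C ⊗ₖ (U * A * V) + B ⊗ₖ (1 : Matrix n n R) =
      (1 : Matrix m m R) ⊗ₖ U * (C ⊗ₖ A + B ⊗ₖ (1 : Matrix n n R)) *
        (1 : Matrix m m R) ⊗ₖ V := by
    simp only [mul_add, add_mul, ← mul_kronecker_mul, one_mul, mul_one, hUV]
  rw [h, charpoly_mul_comm, ← mul_assoc, ← mul_kronecker_mul, hVU, one_mul, one_kronecker_one,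
    one_mul]

theorem Matrix.charpoly_kronecker_diagonal_add {m n R : Type*} [Fintype m] [DecidableEq m]
    [Fintype n] [DecidableEq n] [CommRing R] (B C : Matrix m m R) (d : n → R) :
    (C ⊗ₖ diagonal d + B ⊗ₖ (1 : Matrix n n R)).charpoly = ∏ j, (B + d j • C).charpoly := by
  rw [kronecker_diagonal, kronecker_one, ← blockDiagonal_add, charpoly_blockDiagonal]
  refine Finset.prod_congr rfl fun j _ => ?_
  rw [Pi.add_apply, add_comm, op_smul_eq_smul]

/-- If the real symmetric matrix `A` has eigenvalues `μ₁, …, μₙ`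
(with multiplicity), then the characteristic polynomial of
`D = C ⊗ A + B ⊗ Iₙ` is `∏ⱼ det(x Iₘ − (B + μⱼ C))`. -/
theorem stmt1 {n m : ℕ} (A : Matrix (Fin n) (Fin n) ℝ) (hA : A.IsSymm)
    (μ : Fin n → ℝ) (hμ : A.charpoly = ∏ j, (X - Polynomial.C (μ j)))
    (B Cm : Matrix (Fin m) (Fin m) ℝ) :
    (Cm ⊗ₖ A + B ⊗ₖ (1 : Matrix (Fin n) (Fin n) ℝ)).charpoly
      = ∏ j, (B + μ j • Cm).charpoly := by
  have hH : A.IsHermitian := by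
    rwa [IsHermitian, conjTranspose_eq_transpose_of_trivial]
  have hroots : Finset.univ.val.map hH.eigenvalues = Finset.univ.val.map μ := by
    have h := hH.roots_charpoly_eq_eigenvalues
    rw [hμ, Polynomial.roots_prod _ _
      (Finset.prod_ne_zero_iff.mpr fun j _ => X_sub_C_ne_zero _)] at h
    simpa [Function.comp_def] using h.symm
  have hprod := congrArg (fun s => (s.map fun t => (B + t • Cm).charpoly).prod) hroots
  simp only [Multiset.map_map] at hprod
  conv_lhs => rw [hH.spectral_theorem, Unitary.conjStarAlgAut_apply]
  rw [charpoly_kronecker_conj_add _ _ _ _ _ (Unitary.coe_mul_star_self _),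
    charpoly_kronecker_diagonal_add]
  exact hprod
end

section
/- Let A be an n×n real symmetric matrix having at least two distinct real eigenvalues, let B be an m×m real symmetric matrix and u an index; let f be the characteristic polynomial of B and g the characteristic polynomial of the principal submatrix B^u obtained by deleting row u and column u. Then the following are equivalent: (i) for any two distinct real eigenvalues μ_1 ≠ μ_2 of A, the polynomials f − μ_1·g and f − μ_2·g have no common real root; (ii) f and g are coprime in ℝ[x]. -/
open Matrix Polynomial
open scoped Kronecker

/-- A nonzero split polynomial is coprime to `q` iff it shares no root with `q`. -/
theorem Polynomial.Splits.isCoprime_iff_forall_not_isRoot {K : Type*} [Field K] {p q : K[X]}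
    (hp : p.Splits) (hp0 : p ≠ 0) :
    IsCoprime p q ↔ ∀ x, ¬(p.IsRoot x ∧ q.IsRoot x) := by
  constructor
  · rintro ⟨a, b, h⟩ x ⟨hpx, hqx⟩
    have := congrArg (Polynomial.eval x) h
    simp [hpx.eq_zero, hqx.eq_zero] at this
  · intro h
    refine isCoprime_of_irreducible_dvd (fun h0 => hp0 h0.1) fun z hz hzp hzq => ?_
    obtain ⟨x, hx⟩ := (hp.of_dvd hp0 hzp).exists_eval_eq_zero hz.degree_pos.ne'
    exact h x ⟨IsRoot.dvd hx hzp, IsRoot.dvd hx hzq⟩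

/-- For a symmetric `A` with at least two distinct real eigenvalues,
the polynomials `f − μ₁ g` and `f − μ₂ g` (for distinct real eigenvalues
`μ₁ ≠ μ₂` of `A`) have no common real root iff `f` and `g` are coprime, where
`f, g` are the characteristic polynomials of `B` and of `Bᵘ`. -/
theorem stmt4 {n m : ℕ} (A : Matrix (Fin n) (Fin n) ℝ) (hA : A.IsSymm)
    (hA2 : ∃ μ₁ μ₂ : ℝ, A.charpoly.IsRoot μ₁ ∧ A.charpoly.IsRoot μ₂ ∧ μ₁ ≠ μ₂)
    (B : Matrix (Fin (m + 1)) (Fin (m + 1)) ℝ) (hB : B.IsSymm) (u : Fin (m + 1)) :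
    (∀ μ₁ μ₂ : ℝ, A.charpoly.IsRoot μ₁ → A.charpoly.IsRoot μ₂ → μ₁ ≠ μ₂ →
        ∀ x : ℝ,
          ¬((B.charpoly
              - Polynomial.C μ₁ * (B.submatrix u.succAbove u.succAbove).charpoly).IsRoot x ∧
            (B.charpoly
              - Polynomial.C μ₂ * (B.submatrix u.succAbove u.succAbove).charpoly).IsRoot x))
      ↔ IsCoprime B.charpoly (B.submatrix u.succAbove u.succAbove).charpoly := by
  have hsplit : B.charpoly.Splits := (isHermitian_iff_isSymm.mpr hB).splits_charpoly
  rw [hsplit.isCoprime_iff_forall_not_isRoot B.charpoly_monic.ne_zero]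
  constructor
  · rintro h x ⟨hf, hg⟩
    obtain ⟨μ₁, μ₂, h₁, h₂, hne⟩ := hA2
    apply h μ₁ μ₂ h₁ h₂ hne x
    simp [IsRoot.def, hf.eq_zero, hg.eq_zero]
  · rintro h μ₁ μ₂ - - hne x ⟨h₁, h₂⟩
    simp only [IsRoot.def, eval_sub, eval_mul, eval_C] at h₁ h₂
    have hg : (B.submatrix u.succAbove u.succAbove).charpoly.eval x = 0 := by
      refine (mul_eq_zero.mp ?_).resolve_left (sub_ne_zero.mpr hne)
      linear_combination h₂ - h₁
    refine h x ⟨?_, hg⟩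
    simpa [hg] using h₁
end

section
/- Let B be an m×m real symmetric matrix and u an index; let f be the characteristic polynomial of B and g the characteristic polynomial of the principal submatrix B^u obtained by deleting row u and column u. Then f(x)·g′(x) − f′(x)·g(x) ≠ 0 for every real x if and only if f and g are coprime in ℝ[x]. -/
open Matrix Polynomial

theorem Matrix.map_derivative_mul {l n o R : Type*} [Fintype n] [CommRing R]
    (M : Matrix l n R[X]) (N : Matrix n o R[X]) :
    (M * N).map derivative = M.map derivative * N + M * N.map derivative := by
  ext1 i j
  simp [mul_apply, Finset.sum_add_distrib]

theorem Matrix.map_derivative_charmatrix {n R : Type*} [Fintype n] [DecidableEq n] [CommRing R]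
    (B : Matrix n n R) : B.charmatrix.map derivative = 1 := by
  ext1 i j
  by_cases h : i = j
  · subst h; simp
  · simp [h]

/-- Differentiating `charmatrix B * adjugate (charmatrix B) = charpoly B • 1`. -/
theorem Matrix.adjugate_charmatrix_mul_self {n R : Type*} [Fintype n] [DecidableEq n]
    [CommRing R] (B : Matrix n n R) :
    B.charmatrix.adjugate * B.charmatrix.adjugate =
      derivative B.charpoly • B.charmatrix.adjugate -
        B.charpoly • B.charmatrix.adjugate.map derivative := by
  have h : B.charmatrix.adjugate + B.charmatrix * B.charmatrix.adjugate.map derivative =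
      derivative B.charpoly • (1 : Matrix n n R[X]) := by
    have h := congrArg (fun M => M.map derivative) (mul_adjugate B.charmatrix)
    simp only [map_derivative_mul, map_derivative_charmatrix, one_mul] at h
    rw [h]
    ext1 i j
    by_cases hij : i = j
    · subst hij; simp [charpoly]
    · simp [hij]
  have h2 := congrArg (fun M => B.charmatrix.adjugate * M) h
  simp only [mul_add, ← mul_assoc, adjugate_mul, Matrix.smul_mul, Matrix.mul_smul, one_mul,
    mul_one] at h2
  exact eq_sub_of_add_eq h2

theorem Matrix.charpoly_submatrix_succAbove {m : ℕ} {R : Type*} [CommRing R]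
    (B : Matrix (Fin (m + 1)) (Fin (m + 1)) R) (u : Fin (m + 1)) :
    (B.submatrix u.succAbove u.succAbove).charpoly = B.charmatrix.adjugate u u := by
  rw [adjugate_fin_succ_eq_det_submatrix, Even.neg_one_pow ⟨_, rfl⟩, one_mul, charpoly]
  congr 1
  ext1 i j
  by_cases h : i = j
  · subst h; simp
  · simp [h]

/-- For symmetric `B`, the Wronskian of the characteristic polynomials of `B` and of a principal
submatrix is minus a sum of squares. -/
theorem Matrix.IsSymm.wronskian_charpoly {m : ℕ} {R : Type*} [CommRing R]
    {B : Matrix (Fin (m + 1)) (Fin (m + 1)) R} (hB : B.IsSymm) (u : Fin (m + 1)) :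
    derivative B.charpoly * (B.submatrix u.succAbove u.succAbove).charpoly -
        B.charpoly * derivative (B.submatrix u.succAbove u.succAbove).charpoly =
      ∑ j, B.charmatrix.adjugate j u ^ 2 := by
  have hsymm : B.charmatrix.adjugate.IsSymm := by
    rw [IsSymm, adjugate_transpose, ← charmatrix_transpose, hB.eq]
  have h := congrFun (congrFun (adjugate_charmatrix_mul_self B) u) u
  simp only [mul_apply, sub_apply, smul_apply, map_apply, smul_eq_mul] at h
  rw [charpoly_submatrix_succAbove, ← h]
  refine Finset.sum_congr rfl fun j _ => ?_
  rw [sq, hsymm.apply j u]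

theorem Polynomial.Splits.isCoprime_of_forall_eval {K : Type*} [Field K] {f g : K[X]}
    (hf : f.Splits) (hf0 : f ≠ 0) (h : ∀ x, f.eval x = 0 → g.eval x ≠ 0) : IsCoprime f g := by
  refine isCoprime_of_irreducible_dvd (fun H => hf0 H.1) fun p hp hpf hpg => ?_
  obtain ⟨x, hx⟩ := (hf.of_dvd hf0 hpf).exists_eval_eq_zero (degree_pos_of_irreducible hp).ne'
  exact h x (eval_eq_zero_of_dvd_of_eval_eq_zero hpf hx)
    (eval_eq_zero_of_dvd_of_eval_eq_zero hpg hx)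

/-- For a symmetric matrix `B` and index `u`, the Wronskian
`f·g′ − f′·g` of `f = charpoly B` and `g = charpoly Bᵘ` vanishes at no real `x`
iff `f` and `g` are coprime in `ℝ[x]`. -/
theorem stmt7 {m : ℕ} (B : Matrix (Fin (m + 1)) (Fin (m + 1)) ℝ) (hB : B.IsSymm)
    (u : Fin (m + 1)) (f g : Polynomial ℝ) (hf : f = B.charpoly)
    (hg : g = (B.submatrix u.succAbove u.succAbove).charpoly) :
    (∀ x : ℝ,
        f.eval x * (derivative g).eval x - (derivative f).eval x * g.eval x ≠ 0)
      ↔ IsCoprime f g := by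
  constructor
  · intro h
    have hH : B.IsHermitian := by rwa [IsHermitian, conjTranspose_eq_transpose_of_trivial]
    refine Polynomial.Splits.isCoprime_of_forall_eval (hf ▸ hH.splits_charpoly)
      (hf ▸ B.charpoly_monic.ne_zero) fun x hfx hgx => h x ?_
    rw [hfx, hgx, zero_mul, mul_zero, sub_zero]
  · intro hfg x hx
    have hsum := congrArg (eval x) (hB.wronskian_charpoly u)
    rw [← hf, ← hg, eval_sub, eval_mul, eval_mul, ← neg_sub, hx, neg_zero, eval_finsetSum]
      at hsum
    simp only [eval_pow] at hsum
    have hadj (j) : (B.charmatrix.adjugate j u).eval x = 0 :=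
      pow_eq_zero_iff two_ne_zero |>.1 <|
        (Finset.sum_eq_zero_iff_of_nonneg fun _ _ => sq_nonneg _).1 hsum.symm j
          (Finset.mem_univ j)
    have hgx : g.eval x = 0 := by rw [hg, charpoly_submatrix_succAbove, hadj]
    have hfx : f.eval x = 0 := by
      have h := congrFun (congrFun (mul_adjugate B.charmatrix) u) u
      rw [Matrix.smul_apply, one_apply_eq, smul_eq_mul, mul_one, mul_apply] at h
      rw [hf, charpoly, ← h, eval_finsetSum]
      exact Finset.sum_eq_zero fun j _ => by rw [eval_mul, hadj, mul_zero]
    obtain ⟨a, b, hab⟩ := hfg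
    simpa [hfx, hgx] using congrArg (eval x) hab
end

section
/- Let H be a finite simple graph on m vertices with adjacency matrix A(H), let u be a vertex of H, let f be the characteristic polynomial of A(H) and g the characteristic polynomial of the adjacency matrix of the induced subgraph H − u (equivalently, of the principal submatrix of A(H) obtained by deleting the row and column of u). Then f(x)·g′(x) − f′(x)·g(x) ≤ 0 for every real x. -/
open Matrix Polynomial

namespace Matrix

variable {n R : Type*} [Fintype n] [DecidableEq n] [CommRing R]

theorem adjugate_conj_of_mul_eq_one {P Q : Matrix n n R} (h : P * Q = 1) (M : Matrix n n R) :
    adjugate (P * M * Q) = P * adjugate M * Q := by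
  have h' : Q * P = 1 := mul_eq_one_comm.mp h
  have hQ : adjugate Q = Q.det • P := by
    rw [← Matrix.one_mul (adjugate Q), ← h, Matrix.mul_assoc, mul_adjugate, Matrix.mul_smul,
      Matrix.mul_one]
  have hP : adjugate P = P.det • Q := by
    rw [← Matrix.one_mul (adjugate P), ← h', Matrix.mul_assoc, mul_adjugate, Matrix.mul_smul,
      Matrix.mul_one]
  have hdet : P.det * Q.det = 1 := by rw [← det_mul, h, det_one]
  rw [adjugate_mul_distrib, adjugate_mul_distrib, hP, hQ]
  simp only [Matrix.smul_mul, Matrix.mul_smul, smul_smul, hdet, one_smul, Matrix.mul_assoc]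

theorem charmatrix_conj_of_mul_eq_one {P Q : Matrix n n R} (h : P * Q = 1) (M : Matrix n n R) :
    charmatrix (P * M * Q) = P.map C * charmatrix M * Q.map C := by
  have hC : P.map (C : R →+* R[X]) * Q.map C = 1 := by
    rw [← Matrix.map_mul, h, Matrix.map_one _ (map_zero _) (map_one _)]
  simp only [charmatrix, RingHom.mapMatrix_apply, Matrix.map_mul, Matrix.mul_sub, Matrix.sub_mul]
  rw [← (scalar_commute (X : R[X]) (fun r => Commute.all _ r) _).eq,
    Matrix.mul_assoc (scalar n X), hC, Matrix.mul_one]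

theorem charpoly_submatrix_succAbove_s8 {m : ℕ} (A : Matrix (Fin (m + 1)) (Fin (m + 1)) R)
    (u : Fin (m + 1)) :
    (A.submatrix u.succAbove u.succAbove).charpoly = adjugate (charmatrix A) u u := by
  rw [adjugate_fin_succ_eq_det_submatrix, Even.neg_one_pow ⟨_, rfl⟩, one_mul, charpoly]
  congr 1
  ext1 i j
  simp [charmatrix_apply, diagonal_apply]

theorem IsHermitian.adjugate_charmatrix_apply_self {A : Matrix n n ℝ} (hA : A.IsHermitian)
    (u : n) :
    Matrix.adjugate (charmatrix A) u u = ∑ i, C ((hA.eigenvectorUnitary : Matrix n n ℝ) u i ^ 2) *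
      ∏ j ∈ Finset.univ.erase i, (X - C (hA.eigenvalues j)) := by
  have hU : (hA.eigenvectorUnitary : Matrix n n ℝ) * star (hA.eigenvectorUnitary : Matrix n n ℝ)
      = 1 := Unitary.mul_star_self_of_mem hA.eigenvectorUnitary.2
  have hUC : (hA.eigenvectorUnitary : Matrix n n ℝ).map (C : ℝ →+* ℝ[X]) *
      (star (hA.eigenvectorUnitary : Matrix n n ℝ)).map C = 1 := by
    rw [← Matrix.map_mul, hU, Matrix.map_one _ (map_zero _) (map_one _)]
  conv_lhs => rw [hA.spectral_theorem, Unitary.conjStarAlgAut_apply]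
  rw [charmatrix_conj_of_mul_eq_one hU, adjugate_conj_of_mul_eq_one hUC, charmatrix_diagonal,
    adjugate_diagonal, mul_apply]
  refine Finset.sum_congr rfl fun i _ => ?_
  rw [mul_diagonal]
  simp only [map_apply, star_apply, star_trivial, Function.comp_apply, RCLike.ofReal_real_eq_id,
    id_eq, C_pow]
  ring

theorem IsHermitian.wronskian_charpoly_adjugate_charmatrix {A : Matrix n n ℝ}
    (hA : A.IsHermitian) (u : n) :
    wronskian A.charpoly (Matrix.adjugate (charmatrix A) u u) =
      -∑ i, C ((hA.eigenvectorUnitary : Matrix n n ℝ) u i ^ 2) *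
        (∏ j ∈ Finset.univ.erase i, (X - C (hA.eigenvalues j))) ^ 2 := by
  rw [hA.adjugate_charmatrix_apply_self, wronskian, derivative_sum, Finset.mul_sum,
    Finset.mul_sum, ← Finset.sum_sub_distrib, ← Finset.sum_neg_distrib]
  refine Finset.sum_congr rfl fun i _ => ?_
  have hf : A.charpoly = (X - C (hA.eigenvalues i)) *
      ∏ j ∈ Finset.univ.erase i, (X - C (hA.eigenvalues j)) := by
    rw [hA.charpoly_eq, Finset.mul_prod_erase _ (fun j => X - C (hA.eigenvalues j))
      (Finset.mem_univ i)]
    rfl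
  rw [hf]
  simp only [derivative_mul, derivative_C, derivative_X_sub_C]
  ring

end Matrix

/-- For a finite simple graph `H` with adjacency matrix `A(H)`,
vertex `u`, `f = charpoly A(H)` and `g = charpoly A(H − u)` (the principal
submatrix deleting row and column `u`), one has
`f(x)·g′(x) − f′(x)·g(x) ≤ 0` for every real `x`. -/
theorem stmt8 {m : ℕ} (H : SimpleGraph (Fin (m + 1))) [DecidableRel H.Adj]
    (u : Fin (m + 1)) (f g : Polynomial ℝ)
    (hf : f = (H.adjMatrix ℝ).charpoly)
    (hg : g = ((H.adjMatrix ℝ).submatrix u.succAbove u.succAbove).charpoly) :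
    ∀ x : ℝ,
      f.eval x * (derivative g).eval x - (derivative f).eval x * g.eval x ≤ 0 := by
  intro x
  have hA : (H.adjMatrix ℝ).IsHermitian := by
    rw [IsHermitian, conjTranspose_eq_transpose_of_trivial, H.transpose_adjMatrix]
  have hw := congrArg (eval x) (hA.wronskian_charpoly_adjugate_charmatrix u)
  rw [← charpoly_submatrix_succAbove_s8, ← hf, ← hg, wronskian, eval_sub, eval_mul, eval_mul,
    eval_neg, eval_finsetSum] at hw
  rw [hw, neg_nonpos]
  refine Finset.sum_nonneg fun i _ => ?_
  rw [eval_mul, eval_C, eval_pow]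
  positivity
end

section
/- Let a, d be real numbers with a ≠ 0, and let f, g : ℕ → ℝ[X] be sequences of real polynomials satisfying the recurrences g(n) = (X − 2d)·g(n−1) − a²·g(n−2) for all n ≥ 2 and f(n) = (X − d)·g(n) − a²·g(n−1) for all n ≥ 1. If f(1) and g(1) are coprime in ℝ[X], then f(n) and g(n) are coprime in ℝ[X] for every n ≥ 1. -/
open Polynomial

theorem isCoprime_mul_sub_C_mul_iff {K : Type*} [Field K] {c : K} (hc : c ≠ 0) (p x y : K[X]) :
    IsCoprime (p * x - C c * y) x ↔ IsCoprime y x := by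
  rw [sub_eq_neg_add, IsCoprime.add_mul_right_left_iff, IsCoprime.neg_left_iff,
    isCoprime_mul_unit_left_left (isUnit_C.mpr hc.isUnit)]

/-- Given `a ≠ 0` and sequences of real polynomials satisfying
`g n = (X − 2d) g (n−1) − a² g (n−2)` for `n ≥ 2` and
`f n = (X − d) g n − a² g (n−1)` for `n ≥ 1`, if `f 1` and `g 1` are coprime
then `f n` and `g n` are coprime for every `n ≥ 1`. -/
theorem stmt11 (a d : ℝ) (ha : a ≠ 0) (f g : ℕ → Polynomial ℝ)
    (hg : ∀ n : ℕ, 2 ≤ n →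
      g n = (X - Polynomial.C (2 * d)) * g (n - 1) - Polynomial.C (a ^ 2) * g (n - 2))
    (hf : ∀ n : ℕ, 1 ≤ n →
      f n = (X - Polynomial.C d) * g n - Polynomial.C (a ^ 2) * g (n - 1))
    (h1 : IsCoprime (f 1) (g 1)) :
    ∀ n : ℕ, 1 ≤ n → IsCoprime (f n) (g n) := by
  have ha2 : a ^ 2 ≠ 0 := pow_ne_zero 2 ha
  have hfg : ∀ n : ℕ, 1 ≤ n → (IsCoprime (f n) (g n) ↔ IsCoprime (g (n - 1)) (g n)) := by
    intro n hn
    rw [hf n hn, isCoprime_mul_sub_C_mul_iff ha2]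
  intro n hn
  induction n, hn using Nat.le_induction with
  | base => exact h1
  | succ n hn ih =>
    rw [hfg (n + 1) (by lia), hg (n + 1) (by lia), isCoprime_comm,
      show n + 1 - 2 = n - 1 by lia, Nat.add_sub_cancel, isCoprime_mul_sub_C_mul_iff ha2]
    exact (hfg n hn).mp ih
end
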